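/- arXiv:2603.17585 — 4 statements merged into one kernel-verified Lean document; each statement's English description precedes it below -/
import Mathlib

section
/- Let R, T₀, ρ_l > 0 and A_g, A_l ∈ ℝ be constants, and define the entropy density η(ρ_m, m, Γ) = −(Γ·A_g − Γ·R·ln(ρ_l·Γ) + Γ·R·ln(ρ_l − ρ_m + Γ) + (ρ_m − Γ)·A_l + m²/(2ρ_m)). Then for every fixed m ∈ ℝ and every fixed ρ_m with 0 < ρ_m < ρ_l, the function Γ ↦ η(ρ_m, m, Γ) is strictly convex on the interval (0, ∞). -/
/-- A function on `(a, ∞)` with a first and a positive second derivative is strictly convex. -/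
theorem strictConvexOn_Ioi_of_hasDerivAt2_pos {f f' f'' : ℝ → ℝ} {a : ℝ}
    (hf : ∀ x, a < x → HasDerivAt f (f' x) x)
    (hf' : ∀ x, a < x → HasDerivAt f' (f'' x) x)
    (hpos : ∀ x, a < x → 0 < f'' x) :
    StrictConvexOn ℝ (Set.Ioi a) f := by
  refine strictConvexOn_of_deriv2_pos' (convex_Ioi a)
    (fun x hx => (hf x hx).continuousAt.continuousWithinAt) fun x hx => ?_
  have hderiv : deriv f =ᶠ[nhds x] f' :=
    Filter.eventuallyEq_of_mem (Ioi_mem_nhds hx) fun y hy => (hf y hy).deriv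
  rw [Function.iterate_succ_apply, Function.iterate_one, hderiv.deriv_eq, (hf' x hx).deriv]
  exact hpos x hx

/-- For fixed m ∈ ℝ and fixed ρ_m with 0 < ρ_m < ρ_l, the function
Γ ↦ η(ρ_m, m, Γ) = −(Γ·A_g − Γ·R·ln(ρ_l·Γ) + Γ·R·ln(ρ_l − ρ_m + Γ) + (ρ_m − Γ)·A_l
+ m²/(2ρ_m)) is strictly convex on (0, ∞). -/
theorem entropy_strictConvexOn_Gamma
    (R T₀ ρl Ag Al ρm m : ℝ)
    (hR : 0 < R) (hT : 0 < T₀) (hρl : 0 < ρl) (hρm : 0 < ρm) (hρmρl : ρm < ρl) :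
    StrictConvexOn ℝ (Set.Ioi (0 : ℝ))
      (fun g : ℝ =>
        -(g * Ag - g * R * Real.log (ρl * g) + g * R * Real.log (ρl - ρm + g)
          + (ρm - g) * Al + m ^ 2 / (2 * ρm))) := by
  have hc : 0 < ρl - ρm := sub_pos.mpr hρmρl
  refine strictConvexOn_Ioi_of_hasDerivAt2_pos
    (f' := fun g => R * (Real.log (ρl * g) - Real.log (ρl - ρm + g) + (ρl - ρm) / (ρl - ρm + g))
      - Ag + Al)
    (f'' := fun g => R * (ρl - ρm) ^ 2 / (g * (ρl - ρm + g) ^ 2))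
    (fun g hg => ?_) (fun g hg => ?_) (fun g hg => by positivity)
  all_goals
    have hg' : g ≠ 0 := hg.ne'
    have hs : 0 < ρl - ρm + g := by positivity
    have hlog₁ : HasDerivAt (fun x => Real.log (ρl * x)) (1 / g) g := by
      refine (((hasDerivAt_id' g).const_mul ρl).log (mul_pos hρl hg).ne').congr_deriv ?_
      field_simp
    have hadd : HasDerivAt (fun x => ρl - ρm + x) 1 g := (hasDerivAt_id' g).const_add _
    have hlog₂ := hadd.log hs.ne'
  · have hmulR := (hasDerivAt_id' g).mul_const R
    refine HasDerivAt.congr_deriv (((((((hasDerivAt_id' g).mul_const Ag).sub (hmulR.mul hlog₁)).add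
      (hmulR.mul hlog₂)).add (((hasDerivAt_id' g).const_sub ρm).mul_const Al)).add_const
      (m ^ 2 / (2 * ρm))).neg) ?_
    field_simp
    ring
  · refine HasDerivAt.congr_deriv (((((hlog₁.sub hlog₂).add ((hasDerivAt_const g (ρl - ρm)).div hadd hs.ne')).const_mul
      R).sub_const Ag).add_const Al) ?_
    field_simp
    ring
end

section
/- Let R, ρ_l > 0, A_g, A_l ∈ ℝ, fix m ∈ ℝ and ρ_m with 0 < ρ_m < ρ_l, and let η(ρ_m, m, Γ) = −(Γ·A_g − Γ·R·ln(ρ_l·Γ) + Γ·R·ln(ρ_l − ρ_m + Γ) + (ρ_m − Γ)·A_l + m²/(2ρ_m)) with G(Γ) := ∂η/∂Γ(ρ_m, m, Γ). Let 0 < a ≤ b, suppose Γ* ∈ [a, b] satisfies G(Γ*) = 0, and set c₀ := R·(ρ_l − ρ_m)²/(b·(ρ_l − ρ_m + b)²) > 0. Then for every Γ ∈ [a, b] one has G(Γ)·(Γ − Γ*) ≥ c₀·(Γ − Γ*)². (This is the quantitative entropy production inequality (3.3) underlying the entropy dissipation lemma.) -/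
/-- The `g`-derivative of the homogeneous two-phase entropy density. -/
lemma hasDerivAt_entropyDensity {R ρl Ag Al ρm m g : ℝ} (hρl : 0 < ρl) (hd : 0 < ρl - ρm)
    (hg : 0 < g) :
    HasDerivAt (fun g : ℝ =>
      -(g * Ag - g * R * Real.log (ρl * g) + g * R * Real.log (ρl - ρm + g)
        + (ρm - g) * Al + m ^ 2 / (2 * ρm)))
      (-(Ag - R * Real.log (ρl * g) - R + R * Real.log (ρl - ρm + g)
        + g * R / (ρl - ρm + g) - Al)) g := by
  have hdg : ρl - ρm + g ≠ 0 := by positivity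
  have hid := hasDerivAt_id' g
  have hlog₁ := (hid.const_mul ρl).log (by positivity)
  have hlog₂ := (hid.const_add (ρl - ρm)).log hdg
  refine HasDerivAt.congr_deriv (((((hid.mul_const Ag).sub ((hid.mul_const R).mul hlog₁)).add
    ((hid.mul_const R).mul hlog₂)).add ((hid.const_sub ρm).mul_const Al)).add_const
    (m ^ 2 / (2 * ρm))).neg ?_
  field_simp
  ring

/-- The second `g`-derivative of the homogeneous two-phase entropy density. -/
lemma hasDerivAt_deriv_entropyDensity {R ρl Ag Al ρm g : ℝ} (hρl : 0 < ρl)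
    (hd : 0 < ρl - ρm) (hg : 0 < g) :
    HasDerivAt (fun g : ℝ =>
      -(Ag - R * Real.log (ρl * g) - R + R * Real.log (ρl - ρm + g)
        + g * R / (ρl - ρm + g) - Al))
      (R * (ρl - ρm) ^ 2 / (g * (ρl - ρm + g) ^ 2)) g := by
  have hdg : ρl - ρm + g ≠ 0 := by positivity
  have hid := hasDerivAt_id' g
  have hlog₁ := (hid.const_mul ρl).log (by positivity)
  have hlog₂ := (hid.const_add (ρl - ρm)).log hdg
  refine HasDerivAt.congr_deriv
    ((((((hlog₁.const_mul R).const_sub Ag).sub_const R).add (hlog₂.const_mul R)).add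
    ((hid.mul_const R).div (hid.const_add (ρl - ρm)) hdg)).sub_const Al).neg ?_
  field_simp
  ring

/-- A function vanishing at `y` whose derivative is at least `c` on `[a, b]` satisfies
`c * (x - y) ^ 2 ≤ f x * (x - y)` there. -/
lemma mul_sq_sub_le_mul_sub_of_le_hasDerivAt {f f' : ℝ → ℝ} {a b c x y : ℝ}
    (hf : ∀ z ∈ Set.Icc a b, HasDerivAt f (f' z) z) (hc : ∀ z ∈ Set.Icc a b, c ≤ f' z)
    (hx : x ∈ Set.Icc a b) (hy : y ∈ Set.Icc a b) (hfy : f y = 0) :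
    c * (x - y) ^ 2 ≤ f x * (x - y) := by
  have key := (convex_Icc a b).mul_sub_le_image_sub_of_le_deriv
    (fun z hz => (hf z hz).continuousAt.continuousWithinAt)
    (fun z hz => (hf z (interior_subset hz)).differentiableAt.differentiableWithinAt)
    (C := c) (fun z hz => (hf z (interior_subset hz)).deriv ▸ hc z (interior_subset hz))
  rcases le_total x y with h | h
  · nlinarith [key x hx y hy h]
  · nlinarith [key y hy x hx h]

/-- Quantitative entropy production inequality. With
η(ρ_m, m, Γ) = −(Γ·A_g − Γ·R·ln(ρ_l·Γ) + Γ·R·ln(ρ_l − ρ_m + Γ) + (ρ_m − Γ)·A_l + m²/(2ρ_m)),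
G(Γ) := ∂η/∂Γ(ρ_m, m, Γ), 0 < a ≤ b, Γ* ∈ [a,b] with G(Γ*) = 0, and
c₀ := R·(ρ_l − ρ_m)²/(b·(ρ_l − ρ_m + b)²), one has
G(Γ)·(Γ − Γ*) ≥ c₀·(Γ − Γ*)² for every Γ ∈ [a,b]. -/
theorem entropy_production_inequality
    (R ρl Ag Al ρm m a b Γstar : ℝ)
    (hR : 0 < R) (hρl : 0 < ρl) (hρm : 0 < ρm) (hρmρl : ρm < ρl)
    (ha : 0 < a) (hab : a ≤ b)
    (hΓstar : Γstar ∈ Set.Icc a b)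
    (G : ℝ → ℝ)
    (hG : G = deriv (fun g : ℝ =>
      -(g * Ag - g * R * Real.log (ρl * g) + g * R * Real.log (ρl - ρm + g)
        + (ρm - g) * Al + m ^ 2 / (2 * ρm))))
    (hG0 : G Γstar = 0) :
    ∀ Γ ∈ Set.Icc a b,
      G Γ * (Γ - Γstar) ≥ R * (ρl - ρm) ^ 2 / (b * (ρl - ρm + b) ^ 2) * (Γ - Γstar) ^ 2 := by
  subst hG
  have hd : 0 < ρl - ρm := sub_pos.2 hρmρl
  have hderiv : ∀ g : ℝ, 0 < g → _ := fun g hg =>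
    (hasDerivAt_entropyDensity (R := R) (Ag := Ag) (Al := Al) (m := m) hρl hd hg).deriv
  intro Γ hΓ
  rw [hderiv Γstar (ha.trans_le hΓstar.1)] at hG0
  rw [hderiv Γ (ha.trans_le hΓ.1)]
  refine mul_sq_sub_le_mul_sub_of_le_hasDerivAt
    (fun z hz => hasDerivAt_deriv_entropyDensity hρl hd (ha.trans_le hz.1))
    (fun z hz => ?_) hΓ hΓstar hG0
  have hz0 : 0 < z := ha.trans_le hz.1
  have hb : 0 < b := hz0.trans_le hz.2
  gcongr <;> exact hz.2
end

section
/- Let R, T₀, ρ_l, ε > 0 and let α_eq : ℝ → ℝ be any function. Let Ω ⊆ ℝ² be open and let p, u, α : Ω → ℝ be continuously differentiable with p(t,x) > 0 and 0 < α(t,x) < 1 on Ω. Set ρ_g = p/(R·T₀) and ρ_m = α·ρ_g + (1 − α)·ρ_l. Assume that on Ω: (i) ∂_t ρ_m + ∂_x(ρ_m·u) = 0, and (ii) ∂_t(ρ_g·α) + ∂_x(ρ_g·α·u) = (α_eq(p) − α)/ε. Then on Ω the pressure satisfies the evolution equation ∂_t p = −u·∂_x p − (p/α)·∂_x u − (p/(ε·α·ρ_l))·(1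 − ρ_l·R·T₀/p)·(α_eq(p) − α). -/
/-- Partial derivative in the first (time) variable. -/
noncomputable def pdt (f : ℝ × ℝ → ℝ) (z : ℝ × ℝ) : ℝ := fderiv ℝ f z (1, 0)

/-- Partial derivative in the second (space) variable. -/
noncomputable def pdx (f : ℝ × ℝ → ℝ) (z : ℝ × ℝ) : ℝ := fderiv ℝ f z (0, 1)

/-- Pressure evolution equation. If on an open set Ω, C¹ functions p, u, α
with p > 0 and 0 < α < 1 satisfy the mixture mass equation
∂_t ρ_m + ∂_x(ρ_m·u) = 0 (with ρ_m = α·p/(R·T₀) + (1 − α)·ρ_l) and the gas phase mass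
equation ∂_t(ρ_g·α) + ∂_x(ρ_g·α·u) = (α_eq(p) − α)/ε (with ρ_g = p/(R·T₀)), then on Ω
∂_t p = −u·∂_x p − (p/α)·∂_x u − (p/(ε·α·ρ_l))·(1 − ρ_l·R·T₀/p)·(α_eq(p) − α). -/
theorem pressure_evolution_equation
    (R T₀ ρl ε : ℝ) (αeq : ℝ → ℝ)
    (hR : 0 < R) (hT : 0 < T₀) (hρl : 0 < ρl) (hε : 0 < ε)
    (Ω : Set (ℝ × ℝ)) (hΩ : IsOpen Ω)
    (p u α : ℝ × ℝ → ℝ)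
    (hp : ContDiffOn ℝ 1 p Ω) (hu : ContDiffOn ℝ 1 u Ω) (hα : ContDiffOn ℝ 1 α Ω)
    (hppos : ∀ z ∈ Ω, 0 < p z)
    (hαpos : ∀ z ∈ Ω, 0 < α z) (hαlt : ∀ z ∈ Ω, α z < 1)
    (hmass : ∀ z ∈ Ω,
      pdt (fun w => α w * (p w / (R * T₀)) + (1 - α w) * ρl) z
        + pdx (fun w => (α w * (p w / (R * T₀)) + (1 - α w) * ρl) * u w) z = 0)
    (hgas : ∀ z ∈ Ω,
      pdt (fun w => (p w / (R * T₀)) * α w) z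
        + pdx (fun w => (p w / (R * T₀)) * α w * u w) z
        = (αeq (p z) - α z) / ε) :
    ∀ z ∈ Ω,
      pdt p z = -(u z) * pdx p z - (p z / α z) * pdx u z
        - (p z / (ε * α z * ρl)) * (1 - ρl * R * T₀ / p z) * (αeq (p z) - α z) := by
  intro z hz
  have hΩz := hΩ.mem_nhds hz
  have dp := ((hp.contDiffAt hΩz).differentiableAt one_ne_zero).hasFDerivAt
  have du := ((hu.contDiffAt hΩz).differentiableAt one_ne_zero).hasFDerivAt
  have dα := ((hα.contDiffAt hΩz).differentiableAt one_ne_zero).hasFDerivAt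
  have dρg := dp.mul_const (R * T₀)⁻¹
  have dρm := (dα.mul dρg).add ((dα.const_sub 1).mul_const ρl)
  have dgas := dρg.mul dα
  have hm := hmass z hz
  have hg := hgas z hz
  simp only [pdt, pdx, div_eq_mul_inv (p _) (R * T₀)] at hm hg ⊢
  erw [dρm.fderiv, (dρm.mul du).fderiv] at hm
  erw [dgas.fderiv, (dgas.mul du).fderiv] at hg
  simp only [Pi.add_apply, Pi.mul_apply, add_apply,
    smul_apply, neg_apply, smul_eq_mul] at hm hg
  have hp0 := (hppos z hz).ne'
  have hα0 := (hαpos z hz).ne'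
  generalize fderiv ℝ p z (1, 0) = pt at *
  generalize fderiv ℝ p z (0, 1) = px at *
  generalize fderiv ℝ u z (0, 1) = ux at *
  generalize fderiv ℝ α z (1, 0) = αt at *
  generalize fderiv ℝ α z (0, 1) = αx at *
  field_simp at hm hg ⊢
  have void_fraction_eq :
      αeq (p z) - α z = ρl * ε * (αt + u z * αx - (1 - α z) * ux) := by
    apply mul_left_cancel₀ (mul_pos hR hT).ne'
    linear_combination ε * hm - hg
  linear_combination ρl * hg + p z * void_fraction_eq
end

section
/- Let R, T₀, ρ_l, ε > 0 and let α_eq : ℝ → ℝ be continuously differentiable. Let Ω ⊆ ℝ² be open and let p, u, α : Ω → ℝ be continuously differentiable with p > 0 and 0 < α < 1 on Ω, and set ρ_g = p/(R·T₀), ρ_m = α·ρ_g + (1 − α)·ρ_l. Assume on Ω: (i) ∂_t ρ_m + ∂_x(ρ_m·u) = 0, and (ii) ∂_t(ρ_g·α) + ∂_x(ρ_g·α·u) = (α_eq(p) − α)/ε. Define R^ε := (α − α_eq(p))/ε, Λ(p) := α_eq(p)·ρ_g(p), A := Λ′(p)·p/α − ρ_g·α_eq(p), B₁ := (p/(α·ρ_l))·(1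 − ρ_l·R·T₀/p), and B := −Λ′(p)·B₁. Then on Ω the error term satisfies the transport equation ∂_t(ρ_g·R^ε) + ∂_x(ρ_g·R^ε·u) = (A·∂_x u)/ε + ((B − 1)/ε)·R^ε. -/
/-- The conservative form `∂ₜf + ∂ₓ(f u)` equals the material derivative of `f` plus `f ∂ₓu`. -/
theorem pdt_add_pdx_mul {f u : ℝ × ℝ → ℝ} {z : ℝ × ℝ}
    (hf : DifferentiableAt ℝ f z) (hu : DifferentiableAt ℝ u z) :
    pdt f z + pdx (fun w => f w * u w) z = fderiv ℝ f z (1, u z) + f z * pdx u z := by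
  have hv : ((1, u z) : ℝ × ℝ) = (1, 0) + u z • (0, 1) := by simp
  rw [hv, map_add, map_smul, pdt, pdx, pdx, fderiv_fun_mul hf hu]
  simp only [add_apply, smul_apply, smul_eq_mul]
  ring

/-- Transport equation for the relaxation error. Under the relaxation
system (mixture mass + gas phase mass equations), with R^ε := (α − α_eq(p))/ε,
Λ(q) := α_eq(q)·q/(R·T₀), A := Λ′(p)·p/α − ρ_g·α_eq(p),
B₁ := (p/(α·ρ_l))·(1 − ρ_l·R·T₀/p), B := −Λ′(p)·B₁, the error satisfies
∂_t(ρ_g·R^ε) + ∂_x(ρ_g·R^ε·u) = (A·∂_x u)/ε + ((B − 1)/ε)·R^ε on Ω. -/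
theorem error_transport_equation
    (R T₀ ρl ε : ℝ) (αeq : ℝ → ℝ)
    (hR : 0 < R) (hT : 0 < T₀) (hρl : 0 < ρl) (hε : 0 < ε)
    (hαeq : ContDiff ℝ 1 αeq)
    (Ω : Set (ℝ × ℝ)) (hΩ : IsOpen Ω)
    (p u α : ℝ × ℝ → ℝ)
    (hp : ContDiffOn ℝ 1 p Ω) (hu : ContDiffOn ℝ 1 u Ω) (hα : ContDiffOn ℝ 1 α Ω)
    (hppos : ∀ z ∈ Ω, 0 < p z)
    (hαpos : ∀ z ∈ Ω, 0 < α z) (hαlt : ∀ z ∈ Ω, α z < 1)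
    (hmass : ∀ z ∈ Ω,
      pdt (fun w => α w * (p w / (R * T₀)) + (1 - α w) * ρl) z
        + pdx (fun w => (α w * (p w / (R * T₀)) + (1 - α w) * ρl) * u w) z = 0)
    (hgas : ∀ z ∈ Ω,
      pdt (fun w => (p w / (R * T₀)) * α w) z
        + pdx (fun w => (p w / (R * T₀)) * α w * u w) z
        = (αeq (p z) - α z) / ε) :
    ∀ z ∈ Ω,
      pdt (fun w => (p w / (R * T₀)) * ((α w - αeq (p w)) / ε)) z
        + pdx (fun w => (p w / (R * T₀)) * ((α w - αeq (p w)) / ε) * u w) z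
      = (deriv (fun q => αeq q * (q / (R * T₀))) (p z) * (p z / α z)
            - (p z / (R * T₀)) * αeq (p z)) * pdx u z / ε
        + ((-(deriv (fun q => αeq q * (q / (R * T₀))) (p z)
              * ((p z / (α z * ρl)) * (1 - ρl * R * T₀ / p z))) - 1) / ε)
            * ((α z - αeq (p z)) / ε) := by
  intro z hz
  have hΩz : Ω ∈ nhds z := hΩ.mem_nhds hz
  have hpz : DifferentiableAt ℝ p z := (hp.contDiffAt hΩz).differentiableAt one_ne_zero
  have huz : DifferentiableAt ℝ u z := (hu.contDiffAt hΩz).differentiableAt one_ne_zero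
  have hαz : DifferentiableAt ℝ α z := (hα.contDiffAt hΩz).differentiableAt one_ne_zero
  have hαeqz : DifferentiableAt ℝ αeq (p z) := hαeq.differentiable one_ne_zero _
  have hΛ : HasDerivAt (fun q => αeq q * (q / (R * T₀)))
      (deriv (fun q => αeq q * (q / (R * T₀))) (p z)) (p z) :=
    DifferentiableAt.hasDerivAt (by fun_prop)
  have hΛp := hΛ.comp_hasFDerivAt z hpz.hasFDerivAt
  have hg := hgas z hz
  have hm := hmass z hz
  have hρg := ((hpz.hasFDerivAt.mul_const (R * T₀)⁻¹).mul hαz.hasFDerivAt).congr_of_eventuallyEq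
    (f₁ := fun w => p w / (R * T₀) * α w)
    (.of_forall fun w => by simp only [Pi.mul_apply, div_eq_mul_inv])
  have hρm := (hρg.add ((hαz.hasFDerivAt.const_sub 1).mul_const ρl)).congr_of_eventuallyEq
    (f₁ := fun w => α w * (p w / (R * T₀)) + (1 - α w) * ρl)
    (.of_forall fun w => by simp only [Pi.add_apply]; ring)
  have herr := ((hρg.sub hΛp).mul_const ε⁻¹).congr_of_eventuallyEq
    (f₁ := fun w => p w / (R * T₀) * ((α w - αeq (p w)) / ε))
    (.of_forall fun w => by simp only [Pi.sub_apply, Function.comp_apply]; ring)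
  rw [pdt_add_pdx_mul hρg.differentiableAt huz, hρg.fderiv] at hg
  rw [pdt_add_pdx_mul hρm.differentiableAt huz, hρm.fderiv] at hm
  rw [pdt_add_pdx_mul herr.differentiableAt huz, herr.fderiv]
  simp only [add_apply, sub_apply, neg_apply,
    smul_apply, smul_eq_mul] at hg hm ⊢
  generalize deriv (fun q => αeq q * (q / (R * T₀))) (p z) = Λ' at *
  generalize fderiv ℝ p z (1, u z) = Dp at *
  generalize fderiv ℝ α z (1, u z) = Dα at *
  generalize pdx u z = ux at *
  have hpz0 := (hppos z hz).ne'
  have hαz0 := (hαpos z hz).ne'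
  generalize p z = P at *
  generalize α z = a at *
  generalize αeq P = e at *
  have hDα : Dα = (1 - a) * ux - (a - e) / ε / ρl := by
    have h : Dα * ρl = (1 - a) * ρl * ux - (a - e) / ε := by linear_combination hg - hm
    field_simp at h ⊢
    linear_combination h
  have hDp : Dp = -(P / a) * ux + P / (a * ρl) * (1 - ρl * R * T₀ / P) * ((a - e) / ε) := by
    subst hDα
    field_simp at hg ⊢
    linear_combination hg
  linear_combination hg / ε - Λ' / ε * hDp
end
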